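/- Each of the two operators X₁ = cos θ ∂/∂r − (sin θ / r) ∂/∂θ and X₂ = sin θ ∂/∂r + (cos θ / r) ∂/∂θ, with domain C_c^∞(ℝ₊ × ℝ) in the Hilbert space L²(ℝ₊ × ℝ, r dr dθ), is essentially skew-adjoint: its Hilbert-space adjoint equals the negative of its closure. -/

import Mathlib

open MeasureTheory Set

/-- The measure `r dr dθ` on `ℝ₊ × ℝ` (polar coordinates model of the Riemann
surface of `log z`). -/
noncomputable def polarMeasure : Measure (ℝ × ℝ) :=
  ((volume : Measure (ℝ × ℝ)).restrict (Set.Ioi (0:ℝ) ×ˢ Set.univ)).withDensity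
    fun p => ENNReal.ofReal p.1

/-- `C_c^∞(ℝ₊ × ℝ)`: smooth compactly supported functions with support in `ℝ₊ × ℝ`. -/
def IsLogTest (f : ℝ × ℝ → ℂ) : Prop :=
  ContDiff ℝ (⊤ : ℕ∞) f ∧ HasCompactSupport f ∧ tsupport f ⊆ Set.Ioi (0:ℝ) ×ˢ Set.univ

/-- `X₁ = cos θ ∂/∂r − (sin θ / r) ∂/∂θ`. -/
noncomputable def Xop1 (f : ℝ × ℝ → ℂ) (p : ℝ × ℝ) : ℂ :=
  (Real.cos p.2 : ℂ) * fderiv ℝ f p (1, 0) - ((Real.sin p.2 / p.1 : ℝ) : ℂ) * fderiv ℝ f p (0, 1)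

/-- `X₂ = sin θ ∂/∂r + (cos θ / r) ∂/∂θ`. -/
noncomputable def Xop2 (f : ℝ × ℝ → ℂ) (p : ℝ × ℝ) : ℂ :=
  (Real.sin p.2 : ℂ) * fderiv ℝ f p (1, 0) + ((Real.cos p.2 / p.1 : ℝ) : ℂ) * fderiv ℝ f p (0, 1)

namespace LinearPMap

variable {H : Type*} [NormedAddCommGroup H] [InnerProductSpace ℂ H] [CompleteSpace H]

theorem mem_graph_adjoint_iff {T : H →ₗ.[ℂ] H} (hT : Dense (T.domain : Set H)) (x y : H) :
    (x, y) ∈ T.adjoint.graph ↔ ∀ v : T.domain, inner ℂ y v = inner ℂ x (T v) := by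
  constructor
  · intro h v
    obtain ⟨u, hu, rfl⟩ := (mem_graph_iff _).1 h
    simp only at hu
    rw [← hu]
    exact adjoint_isFormalAdjoint hT u v
  · intro h
    have hx : x ∈ T.adjoint.domain := mem_adjoint_domain_of_exists _ ⟨y, h⟩
    exact (mem_graph_iff _).2 ⟨⟨x, hx⟩, rfl, adjoint_apply_eq hT _ h⟩

/-- The range criterion for essential skew-adjointness of a densely defined skew-symmetric
operator. -/
theorem adjoint_eq_neg_closure_of_skew {T : H →ₗ.[ℂ] H} (hT : Dense (T.domain : Set H))
    (hskew : ∀ u v : T.domain, inner ℂ (T u) (v : H) = -inner ℂ (u : H) (T v))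
    (hadd : ∀ h : H, (∀ v : T.domain, inner ℂ h (T v + (v : H)) = 0) → h = 0)
    (hsub : ∀ h : H, (∀ v : T.domain, inner ℂ h (T v - (v : H)) = 0) → h = 0) :
    T.adjoint = -T.closure := by
  have hcl : ∀ p ∈ T.graph.topologicalClosure, ∀ v : T.domain,
      inner ℂ p.2 (v : H) = -inner ℂ p.1 (T v) := by
    intro p hp v
    have hclosed : _root_.IsClosed {p : H × H | inner ℂ p.2 (v : H) = -inner ℂ p.1 (T v)} :=
      isClosed_eq (by fun_prop) (by fun_prop)
    refine closure_minimal ?_ hclosed hp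
    intro q hq
    obtain ⟨u, hu, hu'⟩ := (mem_graph_iff _).1 hq
    simp only [Set.mem_ofPred_eq, ← hu, ← hu']
    exact hskew u v
  have hclosable : T.IsClosable := by
    refine ⟨T.graph.topologicalClosure.toLinearPMap, ?_⟩
    rw [Submodule.toLinearPMap_graph_eq]
    intro p hp hp0
    refine hT.eq_zero_of_inner_left ℂ fun v hv => ?_
    rw [hcl p hp ⟨v, hv⟩, hp0, inner_zero_left, neg_zero]
  refine eq_of_eq_graph ?_
  ext ⟨x, y⟩
  have hneg : (x, y) ∈ (-T.closure).graph ↔ (x, -y) ∈ T.graph.topologicalClosure := by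
    rw [hclosable.graph_closure_eq_closure_graph, mem_graph_iff, mem_graph_iff]
    constructor
    · rintro ⟨u, hu, hu'⟩
      exact ⟨u, hu, by simp only at hu' ⊢; rw [← hu']; exact (neg_neg _).symm⟩
    · rintro ⟨u, hu, hu'⟩
      exact ⟨u, hu, by
        simp only at hu' ⊢
        rw [← neg_neg y, ← hu']; rfl⟩
  rw [hneg, mem_graph_adjoint_iff hT]
  constructor
  · intro hxy
    set w := x - y with hw
    have hrange : w ∈ _root_.closure (Set.range fun v : T.domain => T v + (v : H)) := by
      let R : Submodule ℂ H := LinearMap.range (T.toFun + T.domain.subtype)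
      have hR : R.topologicalClosure = ⊤ := by
        rw [Submodule.topologicalClosure_eq_top_iff, Submodule.eq_bot_iff]
        intro h hh
        refine hadd h fun v => ?_
        exact (Submodule.mem_orthogonal' _ _).1 hh _ ⟨v, rfl⟩
      have : w ∈ R.topologicalClosure := hR ▸ Submodule.mem_top
      exact this
    obtain ⟨s, hs, hlim⟩ := mem_closure_iff_seq_limit.1 hrange
    choose u hu using hs
    have hnorm : ∀ v : T.domain, ‖(v : H)‖ ≤ ‖T v + (v : H)‖ := by
      intro v
      have hre : RCLike.re (inner ℂ (T v) (v : H)) = 0 := by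
        have h1 := hskew v v
        have h2 := inner_re_symm (𝕜 := ℂ) (T v) (v : H)
        have h4 : RCLike.re (inner ℂ (T v) (v : H)) = -RCLike.re (inner ℂ (v : H) (T v)) := by
          rw [h1]; simp
        linarith
      have h3 := norm_add_sq (𝕜 := ℂ) (T v) (v : H)
      rw [hre] at h3
      exact (sq_le_sq₀ (norm_nonneg _) (norm_nonneg _)).1 (by nlinarith [sq_nonneg ‖T v‖])
    have hcauchy : CauchySeq fun n => (u n : H) := by
      have hs := hlim.cauchySeq
      rw [Metric.cauchySeq_iff] at hs ⊢
      intro ε hε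
      obtain ⟨N, hN⟩ := hs ε hε
      refine ⟨N, fun m hm n hn => lt_of_le_of_lt ?_ (hN m hm n hn)⟩
      rw [dist_eq_norm, dist_eq_norm, ← hu, ← hu]
      have := hnorm (u m - u n)
      rw [map_sub, Submodule.coe_sub] at this
      refine this.trans_eq (congrArg _ ?_)
      dsimp only
      abel
    obtain ⟨z, hz⟩ := cauchySeq_tendsto_of_complete hcauchy
    have hTz : Filter.Tendsto (fun n => T (u n)) Filter.atTop (nhds (w - z)) := by
      refine (hlim.sub hz).congr fun n => ?_
      rw [← hu]; simp
    have hmem : (z, w - z) ∈ T.graph.topologicalClosure :=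
      mem_closure_of_tendsto (hz.prodMk_nhds hTz)
        (Filter.Eventually.of_forall fun n => T.mem_graph (u n))
    have hxz : x - z = 0 := by
      refine hsub _ fun v => ?_
      have h1 := hxy v
      have h2 := hcl _ hmem v
      simp only [hw, inner_sub_left, inner_sub_right] at h1 h2 ⊢
      linear_combination -h1 - h2
    obtain rfl : x = z := sub_eq_zero.1 hxz
    convert hmem using 2
    simp [hw]
  · intro h v
    have := hcl _ h v
    simpa using this

end LinearPMap

/-- Cartesian coordinates on the sheet of the surface of `log z` over the half-plane to the left
of the ray `θ = β`, rotated so that the ray becomes the positive `x`-axis. -/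
noncomputable def polarMap (β : ℝ) (p : ℝ × ℝ) : ℝ × ℝ :=
  (p.1 * Real.cos (p.2 - β), p.1 * Real.sin (p.2 - β))

/-- The inverse of `polarMap β` on the upper half-plane. -/
noncomputable def polarInv (β : ℝ) (z : ℝ × ℝ) : ℝ × ℝ :=
  (√(z.1 ^ 2 + z.2 ^ 2), β + (Real.pi / 2 - Real.arctan (z.1 / z.2)))

/-- The sector `r > 0`, `β < θ < β + π`. -/
def sector (β : ℝ) : Set (ℝ × ℝ) := Set.Ioi 0 ×ˢ Set.Ioo β (β + Real.pi)

theorem isOpen_sector (β : ℝ) : IsOpen (sector β) := isOpen_Ioi.prod isOpen_Ioo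

theorem sector_subset (β : ℝ) : sector β ⊆ Set.Ioi (0 : ℝ) ×ˢ Set.univ :=
  Set.prod_mono subset_rfl (Set.subset_univ _)

theorem sin_pos_of_mem_sector {β : ℝ} {p : ℝ × ℝ} (hp : p ∈ sector β) :
    0 < Real.sin (p.2 - β) := by
  obtain ⟨-, h1, h2⟩ := hp
  exact Real.sin_pos_of_pos_of_lt_pi (by linarith) (by linarith)

theorem polarMap_snd_pos {β : ℝ} {p : ℝ × ℝ} (hp : p ∈ sector β) : 0 < (polarMap β p).2 :=
  mul_pos hp.1 (sin_pos_of_mem_sector hp)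

theorem polarInv_mem_sector (β : ℝ) {z : ℝ × ℝ} (hz : 0 < z.2) : polarInv β z ∈ sector β := by
  have h1 := Real.arctan_lt_pi_div_two (z.1 / z.2)
  have h2 := Real.neg_pi_div_two_lt_arctan (z.1 / z.2)
  exact ⟨Real.sqrt_pos.2 (by positivity), by simp only [polarInv]; linarith,
    by simp only [polarInv]; linarith⟩

theorem polarMap_fst_sq_add_snd_sq (β : ℝ) (p : ℝ × ℝ) :
    (polarMap β p).1 ^ 2 + (polarMap β p).2 ^ 2 = p.1 ^ 2 := by
  simp only [polarMap]
  linear_combination p.1 ^ 2 * Real.sin_sq_add_cos_sq (p.2 - β)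

theorem polarInv_polarMap {β : ℝ} {p : ℝ × ℝ} (hp : p ∈ sector β) :
    polarInv β (polarMap β p) = p := by
  have hr : 0 < p.1 := hp.1
  obtain ⟨-, h1, h2⟩ := hp
  refine Prod.ext ?_ ?_
  · simp only [polarInv, polarMap_fst_sq_add_snd_sq]
    exact Real.sqrt_sq hr.le
  · have htan : (polarMap β p).1 / (polarMap β p).2 = Real.tan (Real.pi / 2 - (p.2 - β)) := by
      rw [Real.tan_eq_sin_div_cos, Real.sin_pi_div_two_sub, Real.cos_pi_div_two_sub]
      exact mul_div_mul_left _ _ hr.ne'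
    simp only [polarInv, htan]
    rw [Real.arctan_tan (by linarith) (by linarith)]
    ring

theorem polarMap_polarInv (β : ℝ) {z : ℝ × ℝ} (hz : 0 < z.2) :
    polarMap β (polarInv β z) = z := by
  have hs : √(z.1 ^ 2 + z.2 ^ 2) = z.2 * √(1 + (z.1 / z.2) ^ 2) := by
    rw [← Real.sqrt_sq hz.le, ← Real.sqrt_mul (sq_nonneg _), Real.sqrt_sq hz.le]
    congr 1
    field_simp
    ring
  have hpos : 0 < √(1 + (z.1 / z.2) ^ 2) := Real.sqrt_pos.2 (by positivity)
  refine Prod.ext ?_ ?_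
  · simp only [polarMap, polarInv, add_sub_cancel_left, Real.cos_pi_div_two_sub, Real.sin_arctan,
      hs]
    field_simp
  · simp only [polarMap, polarInv, add_sub_cancel_left, Real.sin_pi_div_two_sub, Real.cos_arctan,
      hs]
    field_simp

theorem contDiff_polarMap (β : ℝ) : ContDiff ℝ (⊤ : ℕ∞) (polarMap β) := by
  unfold polarMap
  fun_prop

theorem contDiffAt_polarInv (β : ℝ) {z : ℝ × ℝ} (hz : 0 < z.2) :
    ContDiffAt ℝ (⊤ : ℕ∞) (polarInv β) z := by
  unfold polarInv
  refine ContDiffAt.prodMk ?_ ?_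
  · exact ContDiffAt.sqrt (by fun_prop) (by positivity)
  · exact contDiffAt_const.add (contDiffAt_const.sub
      ((contDiffAt_fst.div contDiffAt_snd hz.ne').arctan))

/-- The flow of `∂/∂x` on a sector. -/
noncomputable def sectorFlow (β t : ℝ) (p : ℝ × ℝ) : ℝ × ℝ :=
  polarInv β (polarMap β p + (t, 0))

section sectorFlow

variable {β : ℝ} {p : ℝ × ℝ}

theorem polarMap_add_snd_pos (hp : p ∈ sector β) (t : ℝ) :
    0 < (polarMap β p + (t, 0)).2 := by
  simpa using polarMap_snd_pos hp

theorem sectorFlow_mem (hp : p ∈ sector β) (t : ℝ) : sectorFlow β t p ∈ sector β :=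
  polarInv_mem_sector β (polarMap_add_snd_pos hp t)

theorem sectorFlow_zero (hp : p ∈ sector β) : sectorFlow β 0 p = p := by
  simp only [sectorFlow, Prod.mk_zero_zero, add_zero, polarInv_polarMap hp]

theorem sectorFlow_sectorFlow (hp : p ∈ sector β) (s t : ℝ) :
    sectorFlow β s (sectorFlow β t p) = sectorFlow β (t + s) p := by
  simp only [sectorFlow]
  rw [polarMap_polarInv β (polarMap_add_snd_pos hp t), add_assoc]
  simp

theorem contDiffAt_sectorFlow (hp : p ∈ sector β) (t : ℝ) :
    ContDiffAt ℝ (⊤ : ℕ∞) (sectorFlow β t) p :=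
  (contDiffAt_polarInv β (polarMap_add_snd_pos hp t)).comp p
    ((contDiff_polarMap β).contDiffAt.add contDiffAt_const)

theorem hasDerivAt_sectorFlow_zero (hp : p ∈ sector β) :
    HasDerivAt (fun s => sectorFlow β s p)
      (Real.cos (p.2 - β), -(Real.sin (p.2 - β) / p.1)) 0 := by
  have hr : 0 < p.1 := hp.1
  have hsin := sin_pos_of_mem_sector hp
  have hsum := polarMap_fst_sq_add_snd_sq β p
  have hy := polarMap_snd_pos hp
  simp only [sectorFlow, polarInv]
  set x := (polarMap β p).1 with hx
  set y := (polarMap β p).2 with hy'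
  have hlin : HasDerivAt (fun s : ℝ => (polarMap β p + (s, 0)).1) 1 0 := by
    simpa using (hasDerivAt_id (0 : ℝ)).const_add x
  have hsnd : ∀ s : ℝ, (polarMap β p + (s, 0)).2 = y := fun s => by simp [hy']
  have hfst : (polarMap β p + ((0 : ℝ), 0)).1 = x := by simp [hx]
  simp only [hsnd]
  refine HasDerivAt.prodMk ?_ ?_
  · have h1 := ((hlin.pow 2).add_const (y ^ 2)).sqrt
      (by simp only [Pi.pow_apply, hfst, hsum]; positivity)
    refine h1.congr_deriv ?_
    simp only [Pi.pow_apply, hfst, hsum, Real.sqrt_sq hr.le]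
    rw [hx]
    simp only [polarMap]
    field_simp
    norm_num
    ring
  · have h2 := ((hlin.div_const y).arctan.const_sub (Real.pi / 2)).const_add β
    refine h2.congr_deriv ?_
    rw [hfst]
    have : 1 + (x / y) ^ 2 = p.1 ^ 2 / y ^ 2 := by
      rw [← hsum]; field_simp; ring
    rw [this, hy']
    simp only [polarMap]
    field_simp

end sectorFlow

/-- Smooth functions with compact support inside a sector. -/
def IsSectorTest (β : ℝ) (f : ℝ × ℝ → ℂ) : Prop :=
  ContDiff ℝ (⊤ : ℕ∞) f ∧ HasCompactSupport f ∧ tsupport f ⊆ sector β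

theorem IsSectorTest.isLogTest {β : ℝ} {f : ℝ × ℝ → ℂ} (hf : IsSectorTest β f) : IsLogTest f :=
  ⟨hf.1, hf.2.1, hf.2.2.trans (sector_subset β)⟩

/-- The coordinate field `∂/∂x` for the Cartesian coordinates rotated by the angle `α`. -/
noncomputable def rotatedField (α : ℝ) (f : ℝ × ℝ → ℂ) (p : ℝ × ℝ) : ℂ :=
  (Real.cos (p.2 - α) : ℂ) * fderiv ℝ f p (1, 0) -
    ((Real.sin (p.2 - α) / p.1 : ℝ) : ℂ) * fderiv ℝ f p (0, 1)

theorem rotatedField_eq_fderiv (α : ℝ) (f : ℝ × ℝ → ℂ) (p : ℝ × ℝ) :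
    rotatedField α f p =
      fderiv ℝ f p (Real.cos (p.2 - α), -(Real.sin (p.2 - α) / p.1)) := by
  have h : ((Real.cos (p.2 - α), -(Real.sin (p.2 - α) / p.1)) : ℝ × ℝ) =
      Real.cos (p.2 - α) • ((1 : ℝ), (0 : ℝ)) +
        (-(Real.sin (p.2 - α) / p.1)) • ((0 : ℝ), (1 : ℝ)) := by
    simp
  rw [h, map_add, map_smul, map_smul, Complex.real_smul, Complex.real_smul, rotatedField]
  push_cast
  ring

theorem rotatedField_eq_zero {α : ℝ} {f : ℝ × ℝ → ℂ} {p : ℝ × ℝ} (hp : p ∉ tsupport f) :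
    rotatedField α f p = 0 := by
  rw [rotatedField_eq_fderiv, image_eq_zero_of_notMem_tsupport
    (fun h => hp (tsupport_fderiv_subset ℝ h))]
  rfl

theorem tsupport_rotatedField_subset (α : ℝ) (f : ℝ × ℝ → ℂ) :
    tsupport (rotatedField α f) ⊆ tsupport f :=
  closure_minimal (fun _ hp => by_contra fun h => hp (rotatedField_eq_zero h))
    (isClosed_tsupport f)

theorem contDiffAt_rotatedField (α : ℝ) {f : ℝ × ℝ → ℂ} (hf : ContDiff ℝ (⊤ : ℕ∞) f)
    {p : ℝ × ℝ} (hp : 0 < p.1) : ContDiffAt ℝ (⊤ : ℕ∞) (rotatedField α f) p := by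
  have hf' : ContDiff ℝ (⊤ : ℕ∞) (fderiv ℝ f) := hf.fderiv_right (by simp)
  rw [show rotatedField α f = _ from funext (rotatedField_eq_fderiv α f)]
  refine hf'.contDiffAt.clm_apply ?_
  refine ContDiffAt.prodMk (by fun_prop) (ContDiffAt.neg (ContDiffAt.div ?_ contDiffAt_fst hp.ne'))
  fun_prop

theorem contDiff_of_contDiffAt_tsupport {f : ℝ × ℝ → ℂ}
    (hf : ∀ p ∈ tsupport f, ContDiffAt ℝ (⊤ : ℕ∞) f p) : ContDiff ℝ (⊤ : ℕ∞) f := by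
  refine contDiff_iff_contDiffAt.2 fun p => ?_
  by_cases hp : p ∈ tsupport f
  · exact hf p hp
  · exact contDiffAt_const.congr_of_eventuallyEq (notMem_tsupport_iff_eventuallyEq.1 hp)

theorem IsLogTest.rotatedField {f : ℝ × ℝ → ℂ} (hf : IsLogTest f) (α : ℝ) :
    IsLogTest (rotatedField α f) := by
  have hs := tsupport_rotatedField_subset α f
  exact ⟨contDiff_of_contDiffAt_tsupport fun p hp => contDiffAt_rotatedField α hf.1 (hf.2.2 (hs hp)).1,
    hf.2.1.of_isClosed_subset (isClosed_tsupport _) hs, hs.trans hf.2.2⟩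

/-- The transport of a function on a sector along the flow of `∂/∂x`. -/
noncomputable def sectorTransport (β t : ℝ) (f : ℝ × ℝ → ℂ) : ℝ × ℝ → ℂ :=
  (sector β).indicator fun p => f (sectorFlow β t p)

theorem exists_compact_sectorTransport_eq_zero {β : ℝ} {f : ℝ × ℝ → ℂ} (hf : IsSectorTest β f)
    {I : Set ℝ} (hI : IsCompact I) :
    ∃ K, IsCompact K ∧ K ⊆ sector β ∧ ∀ t ∈ I, ∀ p ∉ K, sectorTransport β t f p = 0 := by
  have hup : ∀ q ∈ I ×ˢ tsupport f, 0 < (polarMap β q.2 - (q.1, 0)).2 := fun q hq => by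
    simpa using polarMap_snd_pos (hf.2.2 hq.2)
  refine ⟨(fun q : ℝ × ℝ × ℝ => polarInv β (polarMap β q.2 - (q.1, 0))) '' I ×ˢ tsupport f,
    (hI.prod hf.2.1).image_of_continuousOn ?_, ?_, ?_⟩
  · intro q hq
    refine ContinuousAt.continuousWithinAt ?_
    refine ContinuousAt.comp (f := fun q : ℝ × ℝ × ℝ => polarMap β q.2 - (q.1, 0))
      (contDiffAt_polarInv β (hup q hq)).continuousAt ?_
    have := (contDiff_polarMap β).continuous
    fun_prop
  · rintro _ ⟨q, hq, rfl⟩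
    exact polarInv_mem_sector β (hup q hq)
  · intro t ht p hpK
    by_cases hp : p ∈ sector β
    · rw [sectorTransport, Set.indicator_of_mem hp]
      by_contra hne
      refine hpK ⟨(t, sectorFlow β t p), ⟨ht, subset_tsupport f hne⟩, ?_⟩
      simp only [sectorFlow, polarMap_polarInv β (polarMap_add_snd_pos hp t), add_sub_cancel_right,
        polarInv_polarMap hp]
    · exact Set.indicator_of_notMem hp _

theorem IsSectorTest.sectorTransport {β : ℝ} {f : ℝ × ℝ → ℂ} (hf : IsSectorTest β f) (t : ℝ) :
    IsSectorTest β (sectorTransport β t f) := by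
  obtain ⟨K, hK, hKs, hK0⟩ := exists_compact_sectorTransport_eq_zero hf
    (isCompact_singleton (x := t))
  have hsub : tsupport (_root_.sectorTransport β t f) ⊆ K :=
    closure_minimal (fun p hp => by_contra fun h => hp (hK0 t rfl p h)) hK.isClosed
  refine ⟨contDiff_of_contDiffAt_tsupport fun p hp => ?_,
    hK.of_isClosed_subset (isClosed_tsupport _) hsub, hsub.trans hKs⟩
  have hpS := hKs (hsub hp)
  refine (hf.1.contDiffAt.comp p (contDiffAt_sectorFlow hpS t)).congr_of_eventuallyEq ?_
  filter_upwards [(isOpen_sector β).mem_nhds hpS] with q hq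
  exact Set.indicator_of_mem hq _

theorem hasDerivAt_comp_sectorFlow {β : ℝ} {f : ℝ × ℝ → ℂ} (hf : IsSectorTest β f)
    {p : ℝ × ℝ} (hp : p ∈ sector β) :
    HasDerivAt (fun s => f (sectorFlow β s p)) (rotatedField β f p) 0 := by
  have h1 : HasFDerivAt f (fderiv ℝ f (sectorFlow β 0 p)) (sectorFlow β 0 p) :=
    (hf.1.differentiable (by simp)).differentiableAt.hasFDerivAt
  have := h1.comp_hasDerivAt (0 : ℝ) (hasDerivAt_sectorFlow_zero hp)
  rwa [sectorFlow_zero hp, ← rotatedField_eq_fderiv] at this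

theorem hasDerivAt_sectorTransport {β : ℝ} {f : ℝ × ℝ → ℂ} (hf : IsSectorTest β f)
    (t : ℝ) (p : ℝ × ℝ) :
    HasDerivAt (fun t => sectorTransport β t f p) (sectorTransport β t (rotatedField β f) p) t := by
  by_cases hp : p ∈ sector β
  · simp only [sectorTransport, Set.indicator_of_mem hp]
    have h := hasDerivAt_comp_sectorFlow hf (sectorFlow_mem hp t)
    simp only [sectorFlow_sectorFlow hp] at h
    have h' : HasDerivAt (fun s => f (sectorFlow β (t + s) p))
      (rotatedField β f (sectorFlow β t p)) (t - t) := by rwa [sub_self]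
    simpa using h'.comp_sub_const t t
  · simpa only [sectorTransport, Set.indicator_of_notMem hp] using hasDerivAt_const t (0 : ℂ)

theorem rotatedField_sectorTransport {β : ℝ} {f : ℝ × ℝ → ℂ} (hf : IsSectorTest β f)
    (t : ℝ) (p : ℝ × ℝ) :
    rotatedField β (sectorTransport β t f) p = sectorTransport β t (rotatedField β f) p := by
  by_cases hp : p ∈ sector β
  · have h1 := hasDerivAt_comp_sectorFlow (hf.sectorTransport t) hp
    have h2 := hasDerivAt_comp_sectorFlow hf (sectorFlow_mem hp t)
    refine h1.unique ?_
    have hflow : (fun s => sectorTransport β t f (sectorFlow β s p)) =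
        fun s => f (sectorFlow β s (sectorFlow β t p)) := by
      funext s
      rw [sectorTransport, Set.indicator_of_mem (sectorFlow_mem hp s), sectorFlow_sectorFlow hp,
        sectorFlow_sectorFlow hp, add_comm]
    rw [hflow, sectorTransport, Set.indicator_of_mem hp]
    exact h2
  · rw [rotatedField_eq_zero fun h => hp ((hf.sectorTransport t).2.2 h), sectorTransport,
      Set.indicator_of_notMem hp]

instance isLocallyFiniteMeasure_polarMeasure : IsLocallyFiniteMeasure polarMeasure :=
  IsLocallyFiniteMeasure.withDensity_ofReal continuous_fst

theorem measurableSet_halfPlane : MeasurableSet (Set.Ioi (0 : ℝ) ×ˢ (Set.univ : Set ℝ)) :=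
  measurableSet_Ioi.prod MeasurableSet.univ

theorem lintegral_polarMeasure (f : ℝ × ℝ → ENNReal) :
    ∫⁻ p, f p ∂polarMeasure =
      ∫⁻ p, (Set.Ioi (0 : ℝ) ×ˢ Set.univ).indicator (fun p => ENNReal.ofReal p.1 * f p) p := by
  rw [polarMeasure, lintegral_withDensity_eq_lintegral_mul_non_measurable _ (by fun_prop)
    (Filter.Eventually.of_forall fun _ => ENNReal.ofReal_lt_top),
    lintegral_indicator measurableSet_halfPlane]
  rfl

theorem integral_polarMeasure {f : ℝ × ℝ → ℂ} (hf : tsupport f ⊆ Set.Ioi (0 : ℝ) ×ˢ Set.univ) :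
    ∫ p, f p ∂polarMeasure = ∫ p, (p.1 : ℂ) * f p := by
  rw [polarMeasure, integral_withDensity_eq_integral_toReal_smul (by fun_prop)
    (Filter.Eventually.of_forall fun _ => ENNReal.ofReal_lt_top),
    ← integral_indicator measurableSet_halfPlane]
  refine integral_congr_ae (Filter.Eventually.of_forall fun p => ?_)
  by_cases hp : p ∈ Set.Ioi (0 : ℝ) ×ˢ (Set.univ : Set ℝ)
  · have : 0 < p.1 := hp.1
    simp only [Set.indicator_of_mem hp, ENNReal.toReal_ofReal this.le, Complex.real_smul]
  · simp only [Set.indicator_of_notMem hp,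
      image_eq_zero_of_notMem_tsupport (fun h => hp (hf h)), mul_zero]

theorem lintegral_indicator_sector_comp_polarMap_le (β : ℝ) (G : ℝ × ℝ → ENNReal) :
    ∫⁻ p, (sector β).indicator (fun p => G (polarMap β p)) p ∂polarMeasure ≤ ∫⁻ z, G z := by
  rw [lintegral_polarMeasure, ← lintegral_add_right_eq_self _ ((0 : ℝ), β),
    ← lintegral_comp_polarCoord_symm G,
    ← lintegral_indicator (polarCoord.open_target.measurableSet)]
  refine lintegral_mono fun p => ?_
  by_cases hp : p + (0, β) ∈ sector β
  · have hp' : p ∈ polarCoord.target := by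
      obtain ⟨h0, h1, h2⟩ := hp
      simp only [Prod.fst_add, Prod.snd_add, add_zero, Set.mem_Ioi] at h0 h1 h2
      exact ⟨h0, by have := Real.pi_pos; linarith, by linarith⟩
    rw [Set.indicator_of_mem hp', Set.indicator_of_mem (sector_subset β hp),
      Set.indicator_of_mem hp]
    simp [polarMap, polarCoord]
  · by_cases hq : p + (0, β) ∈ Set.Ioi (0 : ℝ) ×ˢ (Set.univ : Set ℝ)
    · rw [Set.indicator_of_mem hq, Set.indicator_of_notMem hp, mul_zero]
      exact zero_le
    · rw [Set.indicator_of_notMem hq]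
      exact zero_le

/-- The `L²` norm of the transported function is bounded uniformly in time. -/
theorem exists_lintegral_sectorTransport_le {β : ℝ} {f : ℝ × ℝ → ℂ} (hf : IsSectorTest β f) :
    ∃ C : ENNReal, C ≠ ⊤ ∧
      ∀ t, ∫⁻ p, ‖sectorTransport β t f p‖ₑ ^ 2 ∂polarMeasure ≤ C := by
  let G : ℝ × ℝ → ENNReal :=
    {z : ℝ × ℝ | 0 < z.2}.indicator fun z => ‖f (polarInv β z)‖ₑ ^ 2
  refine ⟨∫⁻ z, G z, ?_, fun t => ?_⟩
  · obtain ⟨M, hM⟩ := hf.2.1.exists_bound_of_continuous hf.1.continuous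
    have hK : IsCompact (polarMap β '' tsupport f) :=
      hf.2.1.image (contDiff_polarMap β).continuous
    have hle : ∀ z, G z ≤ (polarMap β '' tsupport f).indicator
        (fun _ => ENNReal.ofReal M ^ 2) z := by
      intro z
      by_cases hz : 0 < z.2
      · by_cases hz' : z ∈ polarMap β '' tsupport f
        · rw [Set.indicator_of_mem hz']
          refine (Set.indicator_of_mem (s := {z : ℝ × ℝ | 0 < z.2}) hz _).trans_le ?_
          gcongr
          rw [← ofReal_norm]
          exact ENNReal.ofReal_le_ofReal (hM _)
        · refine (Set.indicator_of_mem (s := {z : ℝ × ℝ | 0 < z.2}) hz _).trans_le ?_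
          rw [image_eq_zero_of_notMem_tsupport fun h => hz' ⟨_, h, polarMap_polarInv β hz⟩]
          simp
      · exact (Set.indicator_of_notMem (s := {z : ℝ × ℝ | 0 < z.2}) hz _).trans_le zero_le
    refine ((lintegral_mono hle).trans_lt ?_).ne
    rw [lintegral_indicator_const hK.measurableSet]
    exact ENNReal.mul_lt_top (by simp) hK.measure_lt_top
  · calc ∫⁻ p, ‖sectorTransport β t f p‖ₑ ^ 2 ∂polarMeasure
        = ∫⁻ p, (sector β).indicator (fun p => G (polarMap β p + (t, 0))) p ∂polarMeasure := by
          refine lintegral_congr fun p => ?_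
          by_cases hp : p ∈ sector β
          · rw [sectorTransport, Set.indicator_of_mem hp, Set.indicator_of_mem hp]
            exact (Set.indicator_of_mem (s := {z : ℝ × ℝ | 0 < z.2})
              (polarMap_add_snd_pos hp t) fun z => ‖f (polarInv β z)‖ₑ ^ 2).symm
          · rw [sectorTransport, Set.indicator_of_notMem hp, Set.indicator_of_notMem hp]
            simp
      _ ≤ ∫⁻ z, G (z + (t, 0)) :=
          lintegral_indicator_sector_comp_polarMap_le β fun z => G (z + (t, 0))
      _ = ∫⁻ z, G z := lintegral_add_right_eq_self _ _

theorem integrable_mul_of_isLogTest {h f : ℝ × ℝ → ℂ} (hh : MemLp h 2 polarMeasure)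
    (hf : IsLogTest f) : Integrable (fun p => h p * f p) polarMeasure := by
  have := (hh.locallyIntegrable (by norm_num)).integrable_smul_left_of_hasCompactSupport
    hf.1.continuous hf.2.1
  simpa only [smul_eq_mul, mul_comm] using this

theorem hasDerivAt_integral_sectorTransport {β : ℝ} {h f : ℝ × ℝ → ℂ}
    (hh : MemLp h 2 polarMeasure) (hf : IsSectorTest β f) (t : ℝ) :
    HasDerivAt (fun t => ∫ p, h p * sectorTransport β t f p ∂polarMeasure)
      (∫ p, h p * rotatedField β (sectorTransport β t f) p ∂polarMeasure) t := by
  have hf' : IsSectorTest β (rotatedField β f) :=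
    ⟨(hf.isLogTest.rotatedField β).1, (hf.isLogTest.rotatedField β).2.1,
      (tsupport_rotatedField_subset β f).trans hf.2.2⟩
  obtain ⟨M, hM⟩ := hf'.2.1.exists_bound_of_continuous hf'.1.continuous
  obtain ⟨K, hK, -, hK0⟩ := exists_compact_sectorTransport_eq_zero hf'
    (isCompact_Icc (a := t - 1) (b := t + 1))
  have hloc := hh.locallyIntegrable (by norm_num)
  simp only [rotatedField_sectorTransport hf]
  refine (hasDerivAt_integral_of_dominated_loc_of_deriv_le
    (F := fun t p => h p * sectorTransport β t f p)
    (F' := fun t p => h p * sectorTransport β t (rotatedField β f) p)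
    (bound := K.indicator fun p => ‖h p‖ * M)
    (Icc_mem_nhds (by linarith : t - 1 < t) (by linarith : t < t + 1))
    (Filter.Eventually.of_forall fun s =>
      (integrable_mul_of_isLogTest hh (hf.sectorTransport s).isLogTest).1)
    (integrable_mul_of_isLogTest hh (hf.sectorTransport t).isLogTest)
    (integrable_mul_of_isLogTest hh (hf'.sectorTransport t).isLogTest).1
    (Filter.Eventually.of_forall fun p s hs => ?_) ?_
    (Filter.Eventually.of_forall fun p s _ =>
      (hasDerivAt_sectorTransport hf s p).const_mul (h p))).2
  · by_cases hp : p ∈ K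
    · rw [Set.indicator_of_mem hp, norm_mul]
      gcongr
      by_cases hpS : p ∈ sector β
      · rw [sectorTransport, Set.indicator_of_mem hpS]
        exact hM _
      · rw [sectorTransport, Set.indicator_of_notMem hpS, norm_zero]
        exact (norm_nonneg _).trans (hM p)
    · rw [hK0 s hs p hp, mul_zero, norm_zero, Set.indicator_of_notMem hp]
  · exact (integrable_indicator_iff hK.measurableSet).2
      ((hloc.integrableOn_isCompact hK).norm.mul_const M)

theorem exists_norm_integral_sectorTransport_le {β : ℝ} {h f : ℝ × ℝ → ℂ}
    (hh : MemLp h 2 polarMeasure) (hf : IsSectorTest β f) :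
    ∃ B : ℝ, ∀ t, ‖∫ p, h p * sectorTransport β t f p ∂polarMeasure‖ ≤ B := by
  obtain ⟨C, hC, hCt⟩ := exists_lintegral_sectorTransport_le hf
  have hh2 : ∫⁻ p, ‖h p‖ₑ ^ 2 ∂polarMeasure ≠ ⊤ := by
    have := (lintegral_rpow_enorm_lt_top_of_eLpNorm_lt_top (by norm_num) (by norm_num) hh.2).ne
    simpa using this
  refine ⟨(∫⁻ p, ‖h p‖ₑ ^ 2 ∂polarMeasure + C).toReal, fun t => ?_⟩
  rw [← toReal_enorm]
  refine ENNReal.toReal_mono (ENNReal.add_ne_top.2 ⟨hh2, hC⟩) ?_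
  calc ‖∫ p, h p * sectorTransport β t f p ∂polarMeasure‖ₑ
      ≤ ∫⁻ p, ‖h p * sectorTransport β t f p‖ₑ ∂polarMeasure := enorm_integral_le_lintegral_enorm _
    _ ≤ ∫⁻ p, (‖h p‖ₑ ^ 2 + ‖sectorTransport β t f p‖ₑ ^ 2) ∂polarMeasure := by
        refine lintegral_mono fun p => ?_
        rw [enorm_mul]
        rcases le_total ‖h p‖ₑ ‖sectorTransport β t f p‖ₑ with hle | hle
        · calc _ ≤ ‖sectorTransport β t f p‖ₑ * ‖sectorTransport β t f p‖ₑ := by gcongr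
            _ ≤ _ := by rw [← sq]; exact le_add_self
        · calc _ ≤ ‖h p‖ₑ * ‖h p‖ₑ := by gcongr
            _ ≤ _ := by rw [← sq]; exact le_self_add
    _ = ∫⁻ p, ‖h p‖ₑ ^ 2 ∂polarMeasure + ∫⁻ p, ‖sectorTransport β t f p‖ₑ ^ 2 ∂polarMeasure :=
        lintegral_add_left' (hh.1.enorm.pow_const 2) _
    _ ≤ _ := by gcongr; exact hCt t

theorem eq_zero_of_hasDerivAt_of_bounded {u : ℝ → ℂ} {c B : ℝ} (hc : c ≠ 0)
    (hu : ∀ t, HasDerivAt u (c * u t) t) (hB : ∀ t, ‖u t‖ ≤ B) : u 0 = 0 := by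
  have hconst : ∀ t, HasDerivAt (fun t => Complex.exp (-(c * t : ℝ)) * u t) 0 t := by
    intro t
    have h1 : HasDerivAt (fun t : ℝ => Complex.exp (-(c * t : ℝ)))
        (Complex.exp (-(c * t : ℝ)) * -(c : ℂ)) t := by
      have h2 : HasDerivAt (fun t : ℝ => (-(c * t : ℝ) : ℂ)) (-(c : ℂ)) t := by
        have := ((hasDerivAt_id t).const_mul c).ofReal_comp.neg
        rw [mul_one] at this
        exact this
      exact h2.cexp
    refine (h1.mul (hu t)).congr_deriv ?_
    ring
  have heq : ∀ t, u t = Complex.exp (c * t : ℝ) * u 0 := by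
    intro t
    have := is_const_of_deriv_eq_zero (fun t => (hconst t).differentiableAt)
      (fun t => (hconst t).deriv) t 0
    simp only [mul_zero, Complex.ofReal_zero, neg_zero, Complex.exp_zero, one_mul] at this
    rw [← this, ← mul_assoc, ← Complex.exp_add, add_neg_cancel, Complex.exp_zero, one_mul]
  by_contra h0
  have hpos : 0 < ‖u 0‖ := norm_pos_iff.2 h0
  have h1 := hB ((B / ‖u 0‖) / c)
  rw [heq, mul_div_cancel₀ _ hc, norm_mul, Complex.norm_exp_ofReal] at h1
  have h2 := Real.add_one_le_exp (B / ‖u 0‖)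
  have h3 : (B / ‖u 0‖ + 1) * ‖u 0‖ ≤ B := (mul_le_mul_of_nonneg_right h2 hpos.le).trans h1
  rw [add_mul, div_mul_cancel₀ _ hpos.ne'] at h3
  linarith

theorem integral_mul_eq_zero_of_sector {β c : ℝ} (hc : c ≠ 0) {h : ℝ × ℝ → ℂ}
    (hh : MemLp h 2 polarMeasure)
    (horth : ∀ f, IsSectorTest β f →
      ∫ p, h p * rotatedField β f p ∂polarMeasure = c * ∫ p, h p * f p ∂polarMeasure)
    {f : ℝ × ℝ → ℂ} (hf : IsSectorTest β f) : ∫ p, h p * f p ∂polarMeasure = 0 := by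
  obtain ⟨B, hB⟩ := exists_norm_integral_sectorTransport_le hh hf
  have h0 := eq_zero_of_hasDerivAt_of_bounded hc (fun t =>
    (horth _ (hf.sectorTransport t)) ▸ hasDerivAt_integral_sectorTransport hh hf t) hB
  have hzero : sectorTransport β 0 f = f := by
    funext p
    by_cases hp : p ∈ sector β
    · rw [sectorTransport, Set.indicator_of_mem hp, sectorFlow_zero hp]
    · rw [sectorTransport, Set.indicator_of_notMem hp,
        image_eq_zero_of_notMem_tsupport fun h => hp (hf.2.2 h)]
  simpa only [hzero] using h0

theorem ae_mem_sector (α : ℝ) :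
    ∀ᵐ p ∂polarMeasure, ∃ k : ℤ, p ∈ sector (α + k * Real.pi) := by
  have hac : polarMeasure ≪ (volume : Measure (ℝ × ℝ)) :=
    (withDensity_absolutelyContinuous _ _).trans Measure.restrict_le_self.absolutelyContinuous
  have hpos : ∀ᵐ p ∂polarMeasure, p ∈ Set.Ioi (0 : ℝ) ×ˢ (Set.univ : Set ℝ) :=
    (withDensity_absolutelyContinuous _ _).ae_le (ae_restrict_mem measurableSet_halfPlane)
  have hlines : ∀ᵐ p ∂polarMeasure, ∀ k : ℤ, p.2 ≠ α + k * Real.pi := by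
    refine ae_all_iff.2 fun k => hac.ae_le ?_
    have : (volume : Measure (ℝ × ℝ)) (Set.univ ×ˢ {α + k * Real.pi}) = 0 := by
      rw [Measure.volume_eq_prod, Measure.prod_prod]; simp
    refine measure_mono_null (fun p hp => ?_) this
    simpa using hp
  filter_upwards [hpos, hlines] with p hp hl
  have hpi := Real.pi_pos
  refine ⟨⌊(p.2 - α) / Real.pi⌋, hp.1, lt_of_le_of_ne ?_ (hl _).symm, ?_⟩
  · have := Int.floor_le ((p.2 - α) / Real.pi)
    rw [le_div_iff₀ hpi] at this
    linarith
  · have := Int.lt_floor_add_one ((p.2 - α) / Real.pi)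
    rw [div_lt_iff₀ hpi] at this
    linarith

theorem ae_eq_zero_of_forall_sector (α : ℝ) {h : ℝ × ℝ → ℂ} (hh : MemLp h 2 polarMeasure)
    (horth : ∀ (k : ℤ) (f : ℝ × ℝ → ℂ), IsSectorTest (α + k * Real.pi) f →
      ∫ p, h p * f p ∂polarMeasure = 0) : h =ᵐ[polarMeasure] 0 := by
  have hloc := hh.locallyIntegrable (by norm_num)
  have hk : ∀ᵐ p ∂polarMeasure, ∀ k : ℤ, p ∈ sector (α + k * Real.pi) → h p = 0 := by
    refine ae_all_iff.2 fun k => ?_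
    refine (isOpen_sector _).ae_eq_zero_of_integral_contDiff_smul_eq_zero
      (hloc.locallyIntegrableOn _) fun g hg hgc hgs => ?_
    have hsub : tsupport (fun p => (g p : ℂ)) ⊆ tsupport g :=
      tsupport_comp_subset Complex.ofReal_zero g
    rw [← horth k (fun p => (g p : ℂ)) ⟨Complex.ofRealCLM.contDiff.comp hg,
      hgc.of_isClosed_subset (isClosed_tsupport _) hsub, hsub.trans hgs⟩]
    simp only [Complex.real_smul, mul_comm]
  filter_upwards [hk, ae_mem_sector α] with p hp hp'
  obtain ⟨k, hk⟩ := hp'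
  exact hp k hk

theorem rotatedField_add_int_mul_pi (α : ℝ) (k : ℤ) (f : ℝ × ℝ → ℂ) (p : ℝ × ℝ) :
    rotatedField α f p = ((((-1 : ℝ) ^ k) : ℝ) : ℂ) * rotatedField (α + k * Real.pi) f p := by
  have hsq : ((-1 : ℝ) ^ k) * (-1 : ℝ) ^ k = 1 := by
    rw [← mul_zpow]; simp
  have hsin : Real.sin (p.2 - α) = (-1 : ℝ) ^ k * Real.sin (p.2 - (α + k * Real.pi)) := by
    rw [← sub_sub, Real.sin_sub_int_mul_pi, ← mul_assoc, hsq, one_mul]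
  have hcos : Real.cos (p.2 - α) = (-1 : ℝ) ^ k * Real.cos (p.2 - (α + k * Real.pi)) := by
    rw [← sub_sub, Real.cos_sub_int_mul_pi, ← mul_assoc, hsq, one_mul]
  rw [rotatedField, rotatedField, hsin, hcos]
  push_cast
  ring

/-- A function in `L²` annihilated by the range of `rotatedField α - c` vanishes. -/
theorem ae_eq_zero_of_orthogonal_range (α : ℝ) {c : ℝ} (hc : c ≠ 0) {h : ℝ × ℝ → ℂ}
    (hh : MemLp h 2 polarMeasure)
    (horth : ∀ f, IsLogTest f →
      ∫ p, h p * rotatedField α f p ∂polarMeasure = c * ∫ p, h p * f p ∂polarMeasure) :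
    h =ᵐ[polarMeasure] 0 := by
  refine ae_eq_zero_of_forall_sector α hh fun k f hf => ?_
  have hsq : ((-1 : ℝ) ^ k) * (-1 : ℝ) ^ k = 1 := by
    rw [← mul_zpow]; simp
  refine integral_mul_eq_zero_of_sector (c := (-1 : ℝ) ^ k * c)
    (mul_ne_zero (left_ne_zero_of_mul_eq_one hsq) hc) hh (fun g hg => ?_) hf
  have h1 := horth g hg.isLogTest
  simp only [rotatedField_add_int_mul_pi α k g, mul_left_comm (h _)] at h1
  rw [integral_const_mul] at h1
  have h2 : ((((-1 : ℝ) ^ k) : ℝ) : ℂ) * ((((-1 : ℝ) ^ k) : ℝ) : ℂ) = 1 := by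
    exact_mod_cast hsq
  rw [Complex.ofReal_mul, mul_assoc, ← h1, ← mul_assoc, h2, one_mul]

theorem integral_mul_eq_neg_of_hasLineDerivAt {a a' g : ℝ × ℝ → ℂ} {v : ℝ × ℝ}
    (ha : Continuous a) (ha' : Continuous a') (hder : ∀ p, HasLineDerivAt ℝ a (a' p) p v)
    (hg : ContDiff ℝ (⊤ : ℕ∞) g) (hgc : HasCompactSupport g) :
    Integrable (fun p => a p * fderiv ℝ g p v) ∧ Integrable (fun p => a' p * g p) ∧
      ∫ p, a p * fderiv ℝ g p v = -∫ p, a' p * g p := by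
  have hg' : Continuous fun p => fderiv ℝ g p v :=
    (hg.continuous_fderiv (by simp)).clm_apply continuous_const
  have h1 : Integrable (fun p => a p * fderiv ℝ g p v) :=
    (ha.mul hg').integrable_of_hasCompactSupport (hgc.fderiv_apply ℝ v).mul_left
  have h2 : Integrable (fun p => a' p * g p) :=
    (ha'.mul hg.continuous).integrable_of_hasCompactSupport hgc.mul_left
  have h3 : Integrable (fun p => a p * g p) :=
    (ha.mul hg.continuous).integrable_of_hasCompactSupport hgc.mul_left
  exact ⟨h1, h2, integral_bilinear_hasLineDerivAt_right_eq_neg_left_of_integrable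
    (B := ContinuousLinearMap.mul ℝ ℂ) h2 h1 h3 (fun p _ => hder p) fun p _ =>
      ((hg.differentiable (by simp)).differentiableAt.hasFDerivAt).hasLineDerivAt v⟩

/-- The field `rotatedField α` is divergence free. -/
theorem integral_rotatedField_eq_zero (α : ℝ) {f : ℝ × ℝ → ℂ} (hf : IsLogTest f) :
    ∫ p, rotatedField α f p ∂polarMeasure = 0 := by
  obtain ⟨i1, -, e1⟩ := integral_mul_eq_neg_of_hasLineDerivAt
    (a := fun p => ((p.1 * Real.cos (p.2 - α) : ℝ) : ℂ))
    (a' := fun p => ((Real.cos (p.2 - α) : ℝ) : ℂ)) (v := (1, 0)) (by fun_prop) (by fun_prop)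
    (fun p => by
      have : HasDerivAt (fun t : ℝ => (p.1 + t) * Real.cos (p.2 - α))
          (1 * Real.cos (p.2 - α)) 0 := ((hasDerivAt_id (0 : ℝ)).const_add p.1).mul_const _
      rw [one_mul] at this
      simpa [HasLineDerivAt] using this.ofReal_comp) hf.1 hf.2.1
  obtain ⟨i2, -, e2⟩ := integral_mul_eq_neg_of_hasLineDerivAt
    (a := fun p => ((Real.sin (p.2 - α) : ℝ) : ℂ))
    (a' := fun p => ((Real.cos (p.2 - α) : ℝ) : ℂ)) (v := (0, 1)) (by fun_prop) (by fun_prop)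
    (fun p => by
      have : HasDerivAt (fun t : ℝ => Real.sin (p.2 + t - α))
          (Real.cos (p.2 + 0 - α) * 1) 0 :=
        (((hasDerivAt_id (0 : ℝ)).const_add p.2).sub_const α).sin
      rw [mul_one, add_zero] at this
      simpa [HasLineDerivAt] using this.ofReal_comp) hf.1 hf.2.1
  rw [integral_polarMeasure ((tsupport_rotatedField_subset α f).trans hf.2.2)]
  calc ∫ p, (p.1 : ℂ) * rotatedField α f p
      = ∫ p, (((p.1 * Real.cos (p.2 - α) : ℝ) : ℂ) * fderiv ℝ f p (1, 0) -
          ((Real.sin (p.2 - α) : ℝ) : ℂ) * fderiv ℝ f p (0, 1)) := by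
        refine integral_congr_ae (Filter.Eventually.of_forall fun p => ?_)
        dsimp only
        by_cases hp : p ∈ tsupport f
        · have hr : (p.1 : ℂ) ≠ 0 := Complex.ofReal_ne_zero.2 (ne_of_gt (hf.2.2 hp).1)
          rw [rotatedField]
          push_cast
          field_simp
        · rw [rotatedField_eq_zero hp, image_eq_zero_of_notMem_tsupport
            (fun h => hp (tsupport_fderiv_subset ℝ h))]
          simp
    _ = 0 := by rw [integral_sub i1 i2, e1, e2, sub_self]

theorem IsLogTest.star_mul {f g : ℝ × ℝ → ℂ} (hf : IsLogTest f) (hg : IsLogTest g) :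
    IsLogTest fun p => starRingEnd ℂ (f p) * g p := by
  have hsub : tsupport (fun p => starRingEnd ℂ (f p) * g p) ⊆ tsupport g :=
    tsupport_mul_subset_right
  exact ⟨(Complex.conjCLE.contDiff.comp hf.1).mul hg.1,
    hg.2.1.of_isClosed_subset (isClosed_tsupport _) hsub, hsub.trans hg.2.2⟩

theorem rotatedField_star_mul (α : ℝ) {f g : ℝ × ℝ → ℂ} (hf : IsLogTest f) (hg : IsLogTest g)
    (p : ℝ × ℝ) : rotatedField α (fun p => starRingEnd ℂ (f p) * g p) p =
      starRingEnd ℂ (rotatedField α f p) * g p + starRingEnd ℂ (f p) * rotatedField α g p := by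
  have hf' : HasFDerivAt f (fderiv ℝ f p) p :=
    (hf.1.differentiable (by simp)).differentiableAt.hasFDerivAt
  have hg' : HasFDerivAt g (fderiv ℝ g p) p :=
    (hg.1.differentiable (by simp)).differentiableAt.hasFDerivAt
  have hconj : HasFDerivAt (fun p => starRingEnd ℂ (f p))
      ((Complex.conjCLE : ℂ →L[ℝ] ℂ).comp (fderiv ℝ f p)) p :=
    (Complex.conjCLE : ℂ →L[ℝ] ℂ).hasFDerivAt.comp p hf'
  have hmul : HasFDerivAt (fun p => starRingEnd ℂ (f p) * g p)
      (starRingEnd ℂ (f p) • fderiv ℝ g p +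
        g p • (Complex.conjCLE : ℂ →L[ℝ] ℂ).comp (fderiv ℝ f p)) p := hconj.mul hg'
  rw [rotatedField_eq_fderiv, rotatedField_eq_fderiv, rotatedField_eq_fderiv, hmul.fderiv]
  simp
  ring

theorem integral_star_mul_rotatedField (α : ℝ) {f g : ℝ × ℝ → ℂ} (hf : IsLogTest f)
    (hg : IsLogTest g) :
    ∫ p, starRingEnd ℂ (rotatedField α f p) * g p ∂polarMeasure =
      -∫ p, starRingEnd ℂ (f p) * rotatedField α g p ∂polarMeasure := by
  have hint : ∀ {u : ℝ × ℝ → ℂ}, IsLogTest u → Integrable u polarMeasure := fun hu =>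
    hu.1.continuous.integrable_of_hasCompactSupport hu.2.1
  have h := integral_rotatedField_eq_zero α (hf.star_mul hg)
  simp only [rotatedField_star_mul α hf hg] at h
  rw [integral_add (hint ((hf.rotatedField α).star_mul hg))
    (hint (hf.star_mul (hg.rotatedField α)))] at h
  exact eq_neg_of_add_eq_zero_left h

theorem inner_eq_integral {F G : Lp ℂ 2 polarMeasure} {f g : ℝ × ℝ → ℂ}
    (hf : ⇑F =ᵐ[polarMeasure] f) (hg : ⇑G =ᵐ[polarMeasure] g) :
    inner ℂ F G = ∫ p, starRingEnd ℂ (f p) * g p ∂polarMeasure := by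
  rw [L2.inner_def]
  refine integral_congr_ae ?_
  filter_upwards [hf, hg] with p hp hp'
  rw [hp, hp', RCLike.inner_apply, mul_comm]

/-- The operator `rotatedField α` with domain `C_c^∞(ℝ₊ × ℝ)` is essentially skew-adjoint. -/
theorem adjoint_eq_neg_closure_rotatedField (α : ℝ)
    (T : Lp ℂ 2 polarMeasure →ₗ.[ℂ] Lp ℂ 2 polarMeasure)
    (hdom : ∀ F : Lp ℂ 2 polarMeasure,
      F ∈ T.domain ↔ ∃ f, IsLogTest f ∧ ⇑F =ᵐ[polarMeasure] f)
    (hact : ∀ (v : T.domain) (f : ℝ × ℝ → ℂ), IsLogTest f →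
      ⇑(v : Lp ℂ 2 polarMeasure) =ᵐ[polarMeasure] f →
        ⇑(T v) =ᵐ[polarMeasure] rotatedField α f) :
    T.adjoint = -T.closure := by
  have hlift : ∀ f, IsLogTest f →
      ∃ v : T.domain, ⇑(v : Lp ℂ 2 polarMeasure) =ᵐ[polarMeasure] f := by
    intro f hf
    have hLp : MemLp f 2 polarMeasure := hf.1.continuous.memLp_of_hasCompactSupport hf.2.1
    exact ⟨⟨hLp.toLp f, (hdom _).2 ⟨f, hf, hLp.coeFn_toLp⟩⟩, hLp.coeFn_toLp⟩
  have hstar : ∀ h : Lp ℂ 2 polarMeasure,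
      MemLp (fun p => starRingEnd ℂ (h p)) 2 polarMeasure := fun h => (Lp.memLp h).star
  have hzero : ∀ h : Lp ℂ 2 polarMeasure,
      (fun p => starRingEnd ℂ (h p)) =ᵐ[polarMeasure] 0 → h = 0 := by
    intro h h0
    rw [Lp.eq_zero_iff_ae_eq_zero]
    filter_upwards [h0] with p hp
    simpa using hp
  have hrange : ∀ c : ℝ, c ≠ 0 → ∀ h : Lp ℂ 2 polarMeasure,
      (∀ v : T.domain, inner ℂ h (T v) = c * inner ℂ h (v : Lp ℂ 2 polarMeasure)) → h = 0 := by
    intro c hc h horth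
    refine hzero h (ae_eq_zero_of_orthogonal_range α hc (hstar h) fun f hf => ?_)
    obtain ⟨v, hv⟩ := hlift f hf
    have := horth v
    rwa [inner_eq_integral (Filter.EventuallyEq.refl _ _) (hact v f hf hv),
      inner_eq_integral (Filter.EventuallyEq.refl _ _) hv] at this
  refine LinearPMap.adjoint_eq_neg_closure_of_skew ?_ ?_ ?_ ?_
  · rw [Submodule.dense_iff_topologicalClosure_eq_top, Submodule.topologicalClosure_eq_top_iff,
      Submodule.eq_bot_iff]
    intro h hh
    refine hzero h (ae_eq_zero_of_forall_sector α (hstar h) fun k f hf => ?_)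
    obtain ⟨v, hv⟩ := hlift f hf.isLogTest
    rw [← inner_eq_integral (Filter.EventuallyEq.refl _ _) hv]
    exact (Submodule.mem_orthogonal' _ _).1 hh _ v.2
  · intro u v
    obtain ⟨f, hf, hu⟩ := (hdom _).1 u.2
    obtain ⟨g, hg, hv⟩ := (hdom _).1 v.2
    rw [inner_eq_integral (hact u f hf hu) hv, inner_eq_integral hu (hact v g hg hv),
      integral_star_mul_rotatedField α hf hg]
  · intro h hh
    refine hrange (-1) (by norm_num) h fun v => ?_
    have := hh v
    rw [inner_add_right] at this
    push_cast
    linear_combination this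
  · intro h hh
    refine hrange 1 one_ne_zero h fun v => ?_
    have := hh v
    rw [inner_sub_right] at this
    push_cast
    linear_combination this

theorem rotatedField_zero : rotatedField 0 = Xop1 := by
  funext f p
  simp only [rotatedField, Xop1, sub_zero]

theorem rotatedField_pi_div_two : rotatedField (Real.pi / 2) = Xop2 := by
  funext f p
  simp only [rotatedField, Xop2, Real.cos_sub_pi_div_two, Real.sin_sub_pi_div_two]
  push_cast
  ring

/-- Each of the operators `X₁, X₂` with domain `C_c^∞(ℝ₊ × ℝ)` in
`L²(ℝ₊ × ℝ, r dr dθ)` is essentially skew-adjoint: its adjoint equals the negative of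
its closure.  (`T₁`, `T₂` are the unbounded operators determined by this domain and
action.) -/
theorem stmt4 (T₁ T₂ : Lp ℂ 2 polarMeasure →ₗ.[ℂ] Lp ℂ 2 polarMeasure)
    (hdom₁ : ∀ F : Lp ℂ 2 polarMeasure,
      F ∈ T₁.domain ↔ ∃ f, IsLogTest f ∧ ⇑F =ᵐ[polarMeasure] f)
    (hact₁ : ∀ (v : T₁.domain) (f : ℝ × ℝ → ℂ), IsLogTest f →
      ⇑(v : Lp ℂ 2 polarMeasure) =ᵐ[polarMeasure] f → ⇑(T₁ v) =ᵐ[polarMeasure] Xop1 f)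
    (hdom₂ : ∀ F : Lp ℂ 2 polarMeasure,
      F ∈ T₂.domain ↔ ∃ f, IsLogTest f ∧ ⇑F =ᵐ[polarMeasure] f)
    (hact₂ : ∀ (v : T₂.domain) (f : ℝ × ℝ → ℂ), IsLogTest f →
      ⇑(v : Lp ℂ 2 polarMeasure) =ᵐ[polarMeasure] f → ⇑(T₂ v) =ᵐ[polarMeasure] Xop2 f) :
    T₁.adjoint = -T₁.closure ∧ T₂.adjoint = -T₂.closure := by
  exact ⟨adjoint_eq_neg_closure_rotatedField 0 T₁ hdom₁ (rotatedField_zero ▸ hact₁),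
    adjoint_eq_neg_closure_rotatedField (Real.pi / 2) T₂ hdom₂
      (rotatedField_pi_div_two ▸ hact₂)⟩
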